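/- Let Q : ℝ³ → ℝ be defined by Q(y) = 4(6+|y|²)/(2+|y|²)², and let f : ℝ³ → ℝ be a Schwartz function. Then −∫_{ℝ³} ( (4y/(2+|y|²)) · ∇f(y) ) · f(y) dy = (1/2) ∫_{ℝ³} Q(y)·f(y)² dy, and in particular this quantity is nonnegative. (This is the coercivity of the transport part L₃′f = −∇Δ⁻¹Q·∇f of the linearized operator under the L² inner product, where ∇Δ⁻¹Q(y) = 4y/(2+|y|²).) -/

import Mathlib

open MeasureTheory Filter Matrix
open scoped RealInnerProductSpace BigOperators

noncomputable section

/-- `ℝ³` as a Euclidean space. -/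
abbrev R3 := EuclideanSpace ℝ (Fin 3)

/-- The Laplacian `Δf = ∑ᵢ ∂²f/∂yᵢ²` of a function on `ℝ³` (valued in any normed space). -/
def lap {E : Type*} [NormedAddCommGroup E] [NormedSpace ℝ E] (f : R3 → E) (y : R3) : E :=
  ∑ i : Fin 3,
    fderiv ℝ (fun x => fderiv ℝ f x (EuclideanSpace.single i 1)) y (EuclideanSpace.single i 1)

/-- The explicit self-similar blowup profile of the 3D Keller–Segel equation. -/
def Q (y : R3) : ℝ := 4 * (6 + ‖y‖ ^ 2) / (2 + ‖y‖ ^ 2) ^ 2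

/-- Component of the vector field. -/
def gc (i : Fin 3) (y : R3) : ℝ := 4 * y i / (2 + ‖y‖ ^ 2)

/-- Its derivative in direction `i`. -/
def dgc (i : Fin 3) (y : R3) : ℝ := 4 / (2 + ‖y‖ ^ 2) - 8 * y i ^ 2 / (2 + ‖y‖ ^ 2) ^ 2

lemma coord_sq_le (i : Fin 3) (y : R3) : y i ^ 2 ≤ ‖y‖ ^ 2 := by
  rw [EuclideanSpace.real_norm_sq_eq]
  exact Finset.single_le_sum (f := fun j => y j ^ 2) (fun j _ => sq_nonneg _) (Finset.mem_univ i)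

lemma den_ne (y : R3) : 2 + ‖y‖ ^ 2 ≠ 0 := by positivity

lemma gc_diff (i : Fin 3) : Differentiable ℝ (gc i) := by
  intro y
  have h1 : HasFDerivAt (fun x : R3 => 4 * x i)
      ((4 : ℝ) • (EuclideanSpace.proj i : R3 →L[ℝ] ℝ)) y :=
    (EuclideanSpace.proj i : R3 →L[ℝ] ℝ).hasFDerivAt.const_mul 4
  have h2 : HasFDerivAt (fun x : R3 => 2 + ‖x‖ ^ 2) (2 • (innerSL ℝ y)) y :=
    (hasStrictFDerivAt_norm_sq y).hasFDerivAt.const_add 2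
  have h3 := h1.mul ((hasDerivAt_inv (den_ne y)).comp_hasFDerivAt y h2)
  exact HasFDerivAt.differentiableAt (f := gc i) h3

lemma gc_fderiv (i : Fin 3) (y : R3) :
    fderiv ℝ (gc i) y (EuclideanSpace.single i 1) = dgc i y := by
  have h1 : HasFDerivAt (fun x : R3 => 4 * x i)
      ((4 : ℝ) • (EuclideanSpace.proj i : R3 →L[ℝ] ℝ)) y :=
    (EuclideanSpace.proj i : R3 →L[ℝ] ℝ).hasFDerivAt.const_mul 4
  have h2 : HasFDerivAt (fun x : R3 => 2 + ‖x‖ ^ 2) (2 • (innerSL ℝ y)) y :=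
    (hasStrictFDerivAt_norm_sq y).hasFDerivAt.const_add 2
  have h3 := h1.mul ((hasDerivAt_inv (den_ne y)).comp_hasFDerivAt y h2)
  have h4 : HasFDerivAt (gc i) _ y := h3
  rw [h4.fderiv]
  have := den_ne y
  simp [dgc, EuclideanSpace.inner_single_right]
  field_simp
  ring

lemma gc_bound (i : Fin 3) (y : R3) : ‖gc i y‖ ≤ 4 := by
  have h := coord_sq_le i y
  unfold gc
  rw [norm_div, Real.norm_of_nonneg (by positivity : (0:ℝ) ≤ 2 + ‖y‖ ^ 2),
    div_le_iff₀ (by positivity), Real.norm_eq_abs, abs_le]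
  constructor <;> nlinarith [sq_nonneg (y i - 1), sq_nonneg (y i + 1)]

lemma dgc_bound (i : Fin 3) (y : R3) : ‖dgc i y‖ ≤ 10 := by
  have h := coord_sq_le i y
  have hp : (0:ℝ) ≤ ‖y‖ ^ 2 := by positivity
  unfold dgc
  have h1 : 4 / (2 + ‖y‖ ^ 2) ≤ 2 := by
    rw [div_le_iff₀ (by positivity)]; linarith
  have h2 : 8 * y i ^ 2 / (2 + ‖y‖ ^ 2) ^ 2 ≤ 8 := by
    rw [div_le_iff₀ (by positivity)]; nlinarith
  have h3 : 0 ≤ 4 / (2 + ‖y‖ ^ 2) := by positivity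
  have h4 : 0 ≤ 8 * y i ^ 2 / (2 + ‖y‖ ^ 2) ^ 2 := by positivity
  rw [Real.norm_eq_abs, abs_le]
  constructor <;> linarith

lemma dgc_cont (i : Fin 3) : Continuous (dgc i) := by
  unfold dgc
  refine Continuous.sub ?_ ?_
  · exact Continuous.div (by fun_prop) (by fun_prop) den_ne
  · exact Continuous.div (by fun_prop) (by fun_prop) (fun y => pow_ne_zero 2 (den_ne y))

lemma sum_dgc (y : R3) : ∑ i, dgc i y = Q y := by
  have h := EuclideanSpace.real_norm_sq_eq y
  have hd := den_ne y
  have : ∑ i, dgc i y = 12 / (2 + ‖y‖ ^ 2) - 8 * (∑ i, y i ^ 2) / (2 + ‖y‖ ^ 2) ^ 2 := by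
    simp only [dgc, Fin.sum_univ_three]; ring
  rw [this, ← h, Q]
  field_simp
  ring

lemma f_bdd (f : SchwartzMap R3 ℝ) : ∃ C, ∀ y, ‖f y‖ ≤ C :=
  ⟨_, fun y => (f.toBoundedContinuousFunction).norm_coe_le_norm y⟩

lemma int_ff (f g : SchwartzMap R3 ℝ) : Integrable (fun y => f y * g y) := by
  obtain ⟨C, hC⟩ := f_bdd f
  exact g.integrable.bdd_mul f.continuous.aestronglyMeasurable (ae_of_all _ hC)

lemma int_fdf (f : SchwartzMap R3 ℝ) (v : R3) :
    Integrable (fun y => f y * fderiv ℝ f y v) :=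
  int_ff f (LineDeriv.lineDerivOp v f)

lemma fderiv_sq (f : SchwartzMap R3 ℝ) (y v : R3) :
    fderiv ℝ (fun x => f x ^ 2) y v = 2 * (f y * fderiv ℝ f y v) := by
  have h : HasFDerivAt (fun x => f x ^ 2) _ y := (f.differentiableAt (x := y)).hasFDerivAt.pow 2
  rw [h.fderiv]
  simp
  ring

lemma int_a (f : SchwartzMap R3 ℝ) (i : Fin 3) :
    Integrable (fun y => gc i y * (f y * fderiv ℝ f y (EuclideanSpace.single i 1))) :=
  (int_fdf f _).bdd_mul (gc_diff i).continuous.aestronglyMeasurable (ae_of_all _ (gc_bound i))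

lemma int_sq (f : SchwartzMap R3 ℝ) : Integrable (fun y => f y ^ 2) := by
  simpa [sq] using int_ff f f

lemma int_b (f : SchwartzMap R3 ℝ) (i : Fin 3) :
    Integrable (fun y => dgc i y * f y ^ 2) :=
  (int_sq f).bdd_mul (dgc_cont i).aestronglyMeasurable (ae_of_all _ (dgc_bound i))

lemma ibp (f : SchwartzMap R3 ℝ) (i : Fin 3) :
    2 * ∫ y, gc i y * (f y * fderiv ℝ f y (EuclideanSpace.single i 1))
      = - ∫ y, dgc i y * f y ^ 2 := by
  have h := integral_mul_fderiv_eq_neg_fderiv_mul_of_integrable (μ := (volume : Measure R3))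
    (f := gc i) (g := fun x => f x ^ 2) (v := EuclideanSpace.single i 1)
    (by simpa only [gc_fderiv] using int_b f i)
    (by simp only [fderiv_sq]; 
        refine ((int_a f i).const_mul 2).congr (ae_of_all _ fun y => ?_)
        simp only; ring)
    ((int_sq f).bdd_mul (gc_diff i).continuous.aestronglyMeasurable (ae_of_all _ (gc_bound i)))
    (fun y _ => gc_diff i y) (fun y _ => (f.differentiableAt (x := y)).pow 2)
  simp only [fderiv_sq, gc_fderiv] at h
  rw [← h, ← integral_const_mul]
  congr 1; ext y; ring

lemma inner_eq (f : SchwartzMap R3 ℝ) (y : R3) :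
    ⟪(4 / (2 + ‖y‖ ^ 2)) • y, gradient (fun x => f x) y⟫ * f y
      = ∑ i, gc i y * (f y * fderiv ℝ f y (EuclideanSpace.single i 1)) := by
  have h : y = ∑ i, y i • (EuclideanSpace.single i (1:ℝ) : R3) := by
    ext j; simp [Fin.sum_univ_three]; fin_cases j <;> simp
  have h2 : ⟪y, gradient (fun x => f x) y⟫ = fderiv ℝ f y y := by
    rw [real_inner_comm, gradient, InnerProductSpace.toDual_symm_apply]
  have h3 : fderiv ℝ f y y = ∑ i, y i * fderiv ℝ f y (EuclideanSpace.single i 1) := by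
    have h4 := congrArg (fderiv ℝ f y) h
    rw [map_sum] at h4
    simpa using h4
  rw [real_inner_smul_left, h2, h3]
  simp only [gc, Fin.sum_univ_three]
  ring

/-- coercivity of the transport part `L₃′f = −∇Δ⁻¹Q·∇f` of the linearized
operator in `L²`: for a Schwartz function `f`,
`−∫ ((4y/(2+|y|²))·∇f) f dy = (1/2) ∫ Q f² dy ≥ 0`. -/
theorem stmt8 (f : SchwartzMap R3 ℝ) :
    (-∫ y : R3, ⟪(4 / (2 + ‖y‖ ^ 2)) • y, gradient (fun x => f x) y⟫ * f y)
        = (1 / 2) * ∫ y : R3, Q y * f y ^ 2 ∧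
    0 ≤ -∫ y : R3, ⟪(4 / (2 + ‖y‖ ^ 2)) • y, gradient (fun x => f x) y⟫ * f y := by
  have key : (-∫ y : R3, ⟪(4 / (2 + ‖y‖ ^ 2)) • y, gradient (fun x => f x) y⟫ * f y)
        = (1 / 2) * ∫ y : R3, Q y * f y ^ 2 := by
    simp only [inner_eq, ← sum_dgc, Finset.sum_mul]
    rw [integral_finsetSum _ (fun i _ => int_a f i), integral_finsetSum _ (fun i _ => int_b f i)]
    simp only [Fin.sum_univ_three]
    linarith [ibp f 0, ibp f 1, ibp f 2]
  refine ⟨key, ?_⟩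
  rw [key]
  refine mul_nonneg (by norm_num) (integral_nonneg fun y => ?_)
  simp only [Q, Pi.zero_apply]
  positivity
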